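/- arXiv:2501.03725 — 2 statements merged into one kernel-verified Lean document; each statement's English description precedes it below -/
import Mathlib

section
/- Assume α_r > 2, β_r > 0, α_R > 0, β_R > 0. Then for any constants A > 0 and B ≥ 0 there exist C > 0 and h₀ > 0 such that for all h ≥ h₀, the function AC_X(h) = (A·I₁(h) + B·(I₂(h)+I₃(h))) / (A·I₁(0) + B·(I₂(0)+I₃(0))) satisfies AC_X(h) ≤ C·(A·h^{-α_R} + B·(h^{-α_R} + h^{-(α_r−2)})). -/
open MeasureTheory Set Real Filter

/-- Gamma probability density with shape `α` and scale `β`. -/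
noncomputable def gammaDensity (a b x : ℝ) : ℝ :=
  x ^ (a - 1) * Real.exp (-x / b) / (Real.Gamma a * b ^ a)

/-- `I₁(h)` from Proposition 2. -/
noncomputable def I1 (aR bR h : ℝ) : ℝ :=
  ∫ R in Ioi (0:ℝ), Real.exp (-R * h) * gammaDensity aR bR R

/-- `I₂(h)` from Proposition 2. -/
noncomputable def I2 (ar br aR bR h : ℝ) : ℝ :=
  ∫ P in Ioi (0:ℝ), ∫ R in Ioi (0:ℝ), ∫ r in Ioi (0:ℝ),
    (R * P / (r * (P + R))) * (1 / (P + r) + 1 / (R + r)) * Real.exp (-P * h) *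
      gammaDensity ar br r * gammaDensity aR bR R * gammaDensity aR bR P

/-- `I₃(h)` from Proposition 2, with the integrand extended continuously to `{P = r}`. -/
noncomputable def I3 (ar br aR bR h : ℝ) : ℝ :=
  ∫ P in Ioi (0:ℝ), ∫ R in Ioi (0:ℝ), ∫ r in Ioi (0:ℝ),
    (if P = r then h * Real.exp (-r * h) * (R * P / (r * (R + r)))
      else (R * P / (r * (R + r) * (P - r))) *
        (Real.exp (-r * h) - Real.exp (-P * h))) *
      gammaDensity ar br r * gammaDensity aR bR R * gammaDensity aR bR P

/-- The autocorrelation `AC_X(h)` expressed via `I₁, I₂, I₃`. -/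
noncomputable def ACX (ar br aR bR A B h : ℝ) : ℝ :=
  (A * I1 aR bR h + B * (I2 ar br aR bR h + I3 ar br aR bR h)) /
    (A * I1 aR bR 0 + B * (I2 ar br aR bR 0 + I3 ar br aR bR 0))

theorem aux_int (s b c : ℝ) (hs : 0 < s) (hb : 0 < b) (hc : 0 < c) :
    (∀ t ≥ (0:ℝ), IntegrableOn (fun x => x ^ (s - 1) * Real.exp (-x / b) / c * Real.exp (-x * t))
      (Ioi 0)) ∧
    (∀ t ≥ (0:ℝ), 0 < ∫ x in Ioi (0:ℝ), x ^ (s - 1) * Real.exp (-x / b) / c * Real.exp (-x * t)) ∧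
    (∀ t > (0:ℝ), ∫ x in Ioi (0:ℝ), x ^ (s - 1) * Real.exp (-x / b) / c * Real.exp (-x * t)
      ≤ Real.Gamma s / c * t ^ (-s)) := by
  have key : ∀ t ≥ (0:ℝ), ∫ x in Ioi (0:ℝ), x ^ (s - 1) * Real.exp (-x / b) / c * Real.exp (-x * t)
      = Real.Gamma s / c * (t + 1 / b) ^ (-s) := by
    intro t ht
    have hp : 0 < t + 1 / b := by positivity
    have h1 : ∀ x : ℝ, x ^ (s - 1) * Real.exp (-x / b) / c * Real.exp (-x * t)
        = (1 / c) * (x ^ (s - 1) * Real.exp (-((t + 1 / b) * x))) := by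
      intro x
      have : Real.exp (-((t + 1 / b) * x)) = Real.exp (-x / b) * Real.exp (-x * t) := by
        rw [← Real.exp_add]; congr 1; field_simp; ring
      rw [this]; ring
    simp_rw [h1]
    rw [integral_const_mul, Real.integral_rpow_mul_exp_neg_mul_Ioi hs hp,
      Real.rpow_neg hp.le, one_div (t + 1 / b), Real.inv_rpow hp.le]
    ring
  have pos : ∀ t ≥ (0:ℝ), 0 < ∫ x in Ioi (0:ℝ),
      x ^ (s - 1) * Real.exp (-x / b) / c * Real.exp (-x * t) := by
    intro t ht
    rw [key t ht]
    have := Real.Gamma_pos_of_pos hs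
    have hp : 0 < t + 1 / b := by positivity
    positivity
  refine ⟨fun t ht => ?_, pos, fun t ht => ?_⟩
  · by_contra hn
    exact (pos t ht).ne' (integral_undef hn)
  · rw [key t ht.le]
    have := Real.Gamma_pos_of_pos hs
    refine mul_le_mul_of_nonneg_left ?_ (by positivity)
    exact Real.rpow_le_rpow_of_nonpos ht (by have : 0 < 1 / b := by positivity
                                             linarith) (by linarith)

theorem aux_triple (F : ℝ → ℝ → ℝ → ℝ) (u v : ℝ → ℝ) (c1 c2 t h : ℝ)
    (hF0 : ∀ P > 0, ∀ R > 0, ∀ r > 0, 0 ≤ F P R r)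
    (hF : ∀ P > 0, ∀ R > 0, ∀ r > 0,
      F P R r ≤ (c1 * Real.exp (-r * t) + c2 * Real.exp (-P * h)) * (u r * v R * v P))
    (hut : IntegrableOn (fun x => u x * Real.exp (-x * t)) (Ioi 0))
    (hu0 : IntegrableOn u (Ioi 0)) (hv0 : IntegrableOn v (Ioi 0))
    (hvh : IntegrableOn (fun x => v x * Real.exp (-x * h)) (Ioi 0)) :
    0 ≤ (∫ P in Ioi (0:ℝ), ∫ R in Ioi (0:ℝ), ∫ r in Ioi (0:ℝ), F P R r) ∧
    (∫ P in Ioi (0:ℝ), ∫ R in Ioi (0:ℝ), ∫ r in Ioi (0:ℝ), F P R r) ≤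
      c1 * (∫ x in Ioi (0:ℝ), u x * Real.exp (-x * t)) * (∫ x in Ioi (0:ℝ), v x) *
        (∫ x in Ioi (0:ℝ), v x) +
      c2 * (∫ x in Ioi (0:ℝ), u x) * (∫ x in Ioi (0:ℝ), v x) *
        (∫ x in Ioi (0:ℝ), v x * Real.exp (-x * h)) := by
  set Kt := ∫ x in Ioi (0:ℝ), u x * Real.exp (-x * t)
  set K0 := ∫ x in Ioi (0:ℝ), u x
  set V0 := ∫ x in Ioi (0:ℝ), v x
  set Vh := ∫ x in Ioi (0:ℝ), v x * Real.exp (-x * h)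
  have a0 : ∀ P > 0, ∀ R > 0, 0 ≤ ∫ r in Ioi (0:ℝ), F P R r := fun P hP R hR =>
    setIntegral_nonneg measurableSet_Ioi fun r hr => hF0 P hP R hR r hr
  have a1 : ∀ P > 0, 0 ≤ ∫ R in Ioi (0:ℝ), ∫ r in Ioi (0:ℝ), F P R r := fun P hP =>
    setIntegral_nonneg measurableSet_Ioi fun R hR => a0 P hP R hR
  have b0 : ∀ P > 0, ∀ R > 0, (∫ r in Ioi (0:ℝ), F P R r) ≤
      ((c1 * Kt + c2 * Real.exp (-P * h) * K0) * v P) * v R := by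
    intro P hP R hR
    have i1 : IntegrableOn (fun r => (c1 * v R * v P) * (u r * Real.exp (-r * t))) (Ioi 0) :=
      hut.const_mul _
    have i2 : IntegrableOn (fun r => (c2 * Real.exp (-P * h) * v R * v P) * u r) (Ioi 0) :=
      hu0.const_mul _
    calc _ ≤ ∫ r in Ioi (0:ℝ), ((c1 * v R * v P) * (u r * Real.exp (-r * t)) +
          (c2 * Real.exp (-P * h) * v R * v P) * u r) := by
          refine integral_mono_of_nonneg ?_ (i1.add i2) ?_
          · filter_upwards [ae_restrict_mem measurableSet_Ioi] with r hr
            exact hF0 P hP R hR r hr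
          · filter_upwards [ae_restrict_mem measurableSet_Ioi] with r hr
            refine (hF P hP R hR r hr).trans (le_of_eq ?_)
            ring
      _ = _ := by
          rw [integral_add i1 i2, integral_const_mul, integral_const_mul]
          ring
  have b1 : ∀ P > 0, (∫ R in Ioi (0:ℝ), ∫ r in Ioi (0:ℝ), F P R r) ≤
      (c1 * Kt * V0) * v P + (c2 * K0 * V0) * (v P * Real.exp (-P * h)) := by
    intro P hP
    calc _ ≤ ∫ R in Ioi (0:ℝ), ((c1 * Kt + c2 * Real.exp (-P * h) * K0) * v P) * v R := by
          refine integral_mono_of_nonneg ?_ (hv0.const_mul _) ?_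
          · filter_upwards [ae_restrict_mem measurableSet_Ioi] with R hR
            exact a0 P hP R hR
          · filter_upwards [ae_restrict_mem measurableSet_Ioi] with R hR
            exact b0 P hP R hR
      _ = _ := by
          rw [integral_const_mul]
          ring
  refine ⟨setIntegral_nonneg measurableSet_Ioi fun P hP => a1 P hP, ?_⟩
  have i1 : IntegrableOn (fun P => (c1 * Kt * V0) * v P) (Ioi 0) := hv0.const_mul _
  have i2 : IntegrableOn (fun P => (c2 * K0 * V0) * (v P * Real.exp (-P * h))) (Ioi 0) :=
    hvh.const_mul _
  calc _ ≤ ∫ P in Ioi (0:ℝ), ((c1 * Kt * V0) * v P +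
        (c2 * K0 * V0) * (v P * Real.exp (-P * h))) := by
        refine integral_mono_of_nonneg ?_ (i1.add i2) ?_
        · filter_upwards [ae_restrict_mem measurableSet_Ioi] with P hP
          exact a1 P hP
        · filter_upwards [ae_restrict_mem measurableSet_Ioi] with P hP
          exact b1 P hP
    _ = _ := by
        rw [integral_add i1 i2, integral_const_mul, integral_const_mul]

theorem aux_exp (x y h : ℝ) :
    Real.exp (-x * h) - Real.exp (-y * h) ≤ h * (y - x) * Real.exp (-x * h) := by
  have h1 : Real.exp (-y * h) = Real.exp (-x * h) * Real.exp (-(h * (y - x))) := by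
    rw [← Real.exp_add]; congr 1; ring
  have h2 := Real.add_one_le_exp (-(h * (y - x)))
  rw [h1]
  nlinarith [Real.exp_pos (-x * h)]

theorem aux_quarter (r h : ℝ) :
    r * h * Real.exp (-(r / 2) * h) ≤ 4 * Real.exp (-r * (h / 4)) := by
  have h1 : Real.exp (-r * (h / 4)) = Real.exp (-(r / 2) * h) * Real.exp (r * h / 4) := by
    rw [← Real.exp_add]; congr 1; ring
  have h2 := Real.add_one_le_exp (r * h / 4)
  rw [h1]
  nlinarith [Real.exp_pos (-(r / 2) * h)]

/-- The difference quotient. -/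
noncomputable def dq (P r h : ℝ) : ℝ :=
  if P = r then h * Real.exp (-r * h) else (Real.exp (-r * h) - Real.exp (-P * h)) / (P - r)

theorem dq_nonneg (P r h : ℝ) (hh : 0 ≤ h) : 0 ≤ dq P r h := by
  unfold dq
  split_ifs with e
  · positivity
  · rcases lt_or_gt_of_ne e with l | l
    · refine div_nonneg_of_nonpos ?_ (by linarith)
      have : Real.exp (-r * h) ≤ Real.exp (-P * h) := Real.exp_le_exp.2 (by nlinarith)
      linarith
    · refine div_nonneg ?_ (by linarith)
      have : Real.exp (-P * h) ≤ Real.exp (-r * h) := Real.exp_le_exp.2 (by nlinarith)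
      linarith

theorem dq_le (P r h : ℝ) (hh : 0 ≤ h) (hP : 0 < P) (hr : 0 < r) :
    P * dq P r h ≤ 8 * Real.exp (-r * (h / 4)) + 1 * Real.exp (-P * h) := by
  have q := aux_quarter r h
  have e0 := Real.exp_pos (-P * h)
  have e1 := Real.exp_pos (-r * h)
  have e2 := Real.exp_pos (-(r / 2) * h)
  have e3 : Real.exp (-r * h) ≤ Real.exp (-(r / 2) * h) := Real.exp_le_exp.2 (by nlinarith)
  have e4 : Real.exp (-r * h) ≤ Real.exp (-r * (h / 4)) := Real.exp_le_exp.2 (by nlinarith)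
  have e5 := Real.exp_pos (-r * (h / 4))
  by_cases c1 : 2 * r ≤ P
  · have hd : 0 < P - r := by linarith
    rw [dq, if_neg (by linarith), ← mul_div_assoc, div_le_iff₀ hd]
    nlinarith [mul_pos hd e0, mul_pos hd e1, mul_nonneg (sub_nonneg.2 e4) hd.le, mul_pos hP e0,
      mul_nonneg (sub_nonneg.2 c1) e1.le, mul_pos hd e5]
  by_cases c2 : P ≤ r / 2
  · have hd : 0 < r - P := by linarith
    have : dq P r h = (Real.exp (-P * h) - Real.exp (-r * h)) / (r - P) := by
      rw [dq, if_neg (by linarith), ← neg_div_neg_eq]; congr 1 <;> ring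
    rw [this, ← mul_div_assoc, div_le_iff₀ hd]
    have : P ≤ r - P := by linarith
    nlinarith [mul_pos hd e5, mul_pos hP e1, mul_nonneg (sub_nonneg.2 this) e0.le]
  push Not at c1 c2
  have m : dq P r h ≤ h * Real.exp (-(r / 2) * h) := by
    unfold dq
    split_ifs with e
    · exact mul_le_mul_of_nonneg_left e3 hh
    · rcases lt_or_gt_of_ne e with l | l
      · have hd : 0 < r - P := by linarith
        have e6 : Real.exp (-P * h) ≤ Real.exp (-(r / 2) * h) := Real.exp_le_exp.2 (by nlinarith)
        rw [← neg_div_neg_eq, div_le_iff₀ (by linarith)]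
        have := aux_exp P r h
        nlinarith [mul_le_mul_of_nonneg_left e6 (mul_nonneg hh hd.le)]
      · have hd : 0 < P - r := by linarith
        rw [div_le_iff₀ hd]
        have := aux_exp r P h
        nlinarith [mul_le_mul_of_nonneg_left e3 (mul_nonneg hh hd.le)]
  have d0 := dq_nonneg P r h hh
  calc P * dq P r h ≤ (2 * r) * (h * Real.exp (-(r / 2) * h)) := by gcongr
    _ ≤ _ := by linarith

theorem gd_pos (a b x : ℝ) (ha : 0 < a) (hb : 0 < b) (hx : 0 < x) : 0 < gammaDensity a b x := by
  unfold gammaDensity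
  have := Real.Gamma_pos_of_pos ha
  positivity

theorem aux_main (ar br aR bR : ℝ) (har : 2 < ar) (hbr : 0 < br)
    (haR : 0 < aR) (hbR : 0 < bR) :
    0 < I1 aR bR 0 ∧ (∀ h ≥ 0, 0 ≤ I2 ar br aR bR h) ∧ I3 ar br aR bR 0 = 0 ∧
    ∃ M > 0, ∀ h ≥ 1, I1 aR bR h ≤ M * h ^ (-aR) ∧ I2 ar br aR bR h ≤ M * h ^ (-aR) ∧
      I3 ar br aR bR h ≤ M * (h ^ (-aR) + h ^ (-(ar - 2))) := by
  set cR := Real.Gamma aR * bR ^ aR with hcR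
  set cr := Real.Gamma ar * br ^ ar with hcr
  have hcR0 : 0 < cR := by have := Real.Gamma_pos_of_pos haR; positivity
  have hcr0 : 0 < cr := by
    have := Real.Gamma_pos_of_pos (show 0 < ar by linarith); positivity
  obtain ⟨vi, vp, vb⟩ := aux_int aR bR cR haR hbR hcR0
  obtain ⟨ui, up, ub⟩ := aux_int (ar - 1) br cr (by linarith) hbr hcr0
  set v : ℝ → ℝ := fun x => x ^ (aR - 1) * Real.exp (-x / bR) / cR with hv
  set u : ℝ → ℝ := fun x => x ^ (ar - 1 - 1) * Real.exp (-x / br) / cr with hu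
  have vg : ∀ x, gammaDensity aR bR x = v x := fun x => rfl
  have ug : ∀ x > 0, gammaDensity ar br x = x * u x := by
    intro x hx
    simp only [gammaDensity, hu, ← hcr]
    rw [Real.rpow_sub_one hx.ne' (ar - 1)]
    field_simp
  have vpos : ∀ x > 0, 0 < v x := fun x hx => by rw [← vg]; exact gd_pos _ _ _ haR hbR hx
  have upos : ∀ x > 0, 0 < u x := fun x hx => by
    have := gd_pos ar br x (by linarith) hbr hx
    rw [ug x hx] at this
    exact pos_of_mul_pos_right this hx.le
  have v0 : IntegrableOn v (Ioi 0) := by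
    have := vi 0 le_rfl; simpa [hv] using this
  have u0 : IntegrableOn u (Ioi 0) := by
    have := ui 0 le_rfl; simpa [hu] using this
  set V0 := ∫ x in Ioi (0:ℝ), v x with hV0
  set U0 := ∫ x in Ioi (0:ℝ), u x with hU0
  have V0p : 0 < V0 := by
    have := vp 0 le_rfl; simpa [hV0, hv] using this
  have U0p : 0 < U0 := by
    have := up 0 le_rfl; simpa [hU0, hu] using this
  have I1eq : ∀ h, I1 aR bR h = ∫ x in Ioi (0:ℝ), v x * Real.exp (-x * h) := by
    intro h
    unfold I1
    congr 1; ext x; rw [vg, mul_comm]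
  have T2 : ∀ h ≥ (0:ℝ), _ := fun (h : ℝ) (hh : (0:ℝ) ≤ h) => aux_triple
    (fun P R r => (R * P / (r * (P + R))) * (1 / (P + r) + 1 / (R + r)) * Real.exp (-P * h) *
      gammaDensity ar br r * gammaDensity aR bR R * gammaDensity aR bR P) u v 0 2 0 h
    (by
      intro P hP R hR r hr
      have g1 := gd_pos ar br r (by linarith) hbr hr
      have g2 := gd_pos aR bR R haR hbR hR
      have g3 := gd_pos aR bR P haR hbR hP
      positivity)
    (by
      intro P hP R hR r hr
      simp only [vg, ug r hr]
      have g1 := upos r hr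
      have g2 := vpos R hR
      have g3 := vpos P hP
      have k : (R * P / (r * (P + R))) * (1 / (P + r) + 1 / (R + r)) * r ≤ 2 := by
        have : (R * P / (r * (P + R))) * (1 / (P + r) + 1 / (R + r)) * r
          = (R / (P + R)) * (P / (P + r)) + (P / (P + R)) * (R / (R + r)) := by
          field_simp
        rw [this]
        have a1 : R / (P + R) ≤ 1 := by rw [div_le_one (by positivity)]; linarith
        have a2 : P / (P + r) ≤ 1 := by rw [div_le_one (by positivity)]; linarith
        have a3 : P / (P + R) ≤ 1 := by rw [div_le_one (by positivity)]; linarith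
        have a4 : R / (R + r) ≤ 1 := by rw [div_le_one (by positivity)]; linarith
        have := mul_le_one₀ a1 (by positivity) a2
        have := mul_le_one₀ a3 (by positivity) a4
        linarith
      have w : 0 ≤ Real.exp (-P * h) * (u r * v R * v P) := by positivity
      have := mul_le_mul_of_nonneg_right k w
      linarith)
    (ui 0 le_rfl) u0 v0 (vi h hh)
  have T3 : ∀ h ≥ (0:ℝ), _ := fun (h : ℝ) (hh : (0:ℝ) ≤ h) => aux_triple
    (fun P R r => (if P = r then h * Real.exp (-r * h) * (R * P / (r * (R + r)))
      else (R * P / (r * (R + r) * (P - r))) *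
        (Real.exp (-r * h) - Real.exp (-P * h))) *
      gammaDensity ar br r * gammaDensity aR bR R * gammaDensity aR bR P) u v 8 1 (h / 4) h
    (by
      intro P hP R hR r hr
      have g1 := gd_pos ar br r (by linarith) hbr hr
      have g2 := gd_pos aR bR R haR hbR hR
      have g3 := gd_pos aR bR P haR hbR hP
      have e : (if P = r then h * Real.exp (-r * h) * (R * P / (r * (R + r)))
        else (R * P / (r * (R + r) * (P - r))) *
        (Real.exp (-r * h) - Real.exp (-P * h))) = (R * P / (r * (R + r))) * dq P r h := by
        unfold dq
        split_ifs with c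
        · ring
        · have : P - r ≠ 0 := sub_ne_zero.2 c
          field_simp
      have := dq_nonneg P r h hh
      simp only [e]
      positivity)
    (by
      intro P hP R hR r hr
      have e : (if P = r then h * Real.exp (-r * h) * (R * P / (r * (R + r)))
        else (R * P / (r * (R + r) * (P - r))) *
        (Real.exp (-r * h) - Real.exp (-P * h))) = (R * P / (r * (R + r))) * dq P r h := by
        unfold dq
        split_ifs with c
        · ring
        · have : P - r ≠ 0 := sub_ne_zero.2 c
          field_simp
      have d0 := dq_nonneg P r h hh
      have d1 := dq_le P r h hh hP hr
      simp only [e, vg, ug r hr]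
      have g1 := upos r hr
      have g2 := vpos R hR
      have g3 := vpos P hP
      have a4 : R / (R + r) ≤ 1 := by rw [div_le_one (by positivity)]; linarith
      have k : (R / (R + r)) * (P * dq P r h) ≤ P * dq P r h :=
        mul_le_of_le_one_left (by positivity) a4
      have w : 0 ≤ (u r * v R * v P) := by positivity
      have := mul_le_mul_of_nonneg_right (k.trans d1) w
      refine le_trans (le_of_eq ?_) this
      field_simp)
    (ui (h / 4) (by positivity)) u0 v0 (vi h hh)
  refine ⟨?_, fun h hh => (T2 h hh).1, ?_, ?_⟩
  · rw [I1eq]; exact vp 0 le_rfl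
  · simp [I3]
  set G := Real.Gamma aR / cR with hG
  set H := Real.Gamma (ar - 1) / cr * 4 ^ (ar - 1) with hH
  have G0 : 0 < G := by have := Real.Gamma_pos_of_pos haR; positivity
  have H0 : 0 < H := by
    have := Real.Gamma_pos_of_pos (show 0 < ar - 1 by linarith); positivity
  refine ⟨G + 2 * U0 * V0 * G + (8 * H * V0 * V0), by positivity, ?_⟩
  intro h hh
  have h0 : 0 < h := by linarith
  have x0 : 0 < h ^ (-aR) := by positivity
  have y0 : 0 < h ^ (-(ar - 2)) := by positivity
  have B1 : (∫ x in Ioi (0:ℝ), v x * Real.exp (-x * h)) ≤ G * h ^ (-aR) := vb h h0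
  have B2 : (∫ x in Ioi (0:ℝ), u x * Real.exp (-x * (h / 4))) ≤ H * h ^ (-(ar - 2)) := by
    refine (ub (h / 4) (by positivity)).trans ?_
    have : (h / 4) ^ (-(ar - 1)) = 4 ^ (ar - 1) * h ^ (-(ar - 1)) := by
      rw [Real.div_rpow h0.le (by norm_num), Real.rpow_neg (show (0:ℝ) ≤ 4 by norm_num)]
      field_simp
    rw [this, ← mul_assoc]
    refine mul_le_mul_of_nonneg_left ?_ H0.le
    exact Real.rpow_le_rpow_of_exponent_le hh (by linarith)
  have p1 : 0 < G * h ^ (-aR) := by positivity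
  have p2 : 0 < 2 * U0 * V0 * G * h ^ (-aR) := by positivity
  have p3 : 0 < 8 * H * V0 * V0 * h ^ (-aR) := by positivity
  have p4 : 0 < G * h ^ (-(ar - 2)) := by positivity
  have p5 : 0 < 2 * U0 * V0 * G * h ^ (-(ar - 2)) := by positivity
  have p6 : 0 < 8 * H * V0 * V0 * h ^ (-(ar - 2)) := by positivity
  have C1 := mul_le_mul_of_nonneg_left B1 (show 0 ≤ U0 * V0 by positivity)
  have C2 := mul_le_mul_of_nonneg_left B2 (show 0 ≤ V0 * V0 by positivity)
  refine ⟨?_, ?_, ?_⟩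
  · rw [I1eq]; linarith
  · refine (T2 h h0.le).2.trans ?_
    simp only [← hV0, ← hU0]
    linarith
  · refine (T3 h h0.le).2.trans ?_
    simp only [← hV0, ← hU0]
    linarith

theorem stmt7 (ar br aR bR A B : ℝ) (har : 2 < ar) (hbr : 0 < br)
    (haR : 0 < aR) (hbR : 0 < bR) (hA : 0 < A) (hB : 0 ≤ B) :
    ∃ C > (0:ℝ), ∃ h₀ > (0:ℝ), ∀ h ≥ h₀,
      ACX ar br aR bR A B h ≤
        C * (A * h ^ (-aR) + B * (h ^ (-aR) + h ^ (-(ar - 2)))) := by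
  obtain ⟨p, q, z, M, hM, hb⟩ := aux_main ar br aR bR har hbr haR hbR
  have D0 : 0 < A * I1 aR bR 0 + B * (I2 ar br aR bR 0 + I3 ar br aR bR 0) := by
    have := q 0 le_rfl
    rw [z]; positivity
  refine ⟨2 * M / (A * I1 aR bR 0 + B * (I2 ar br aR bR 0 + I3 ar br aR bR 0)), by positivity,
    1, one_pos, fun h hh => ?_⟩
  have h0 : 0 < h := by linarith
  have x0 : 0 < h ^ (-aR) := by positivity
  have y0 : 0 < h ^ (-(ar - 2)) := by positivity
  obtain ⟨b1, b2, b3⟩ := hb h hh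
  rw [ACX, div_mul_eq_mul_div]
  refine div_le_div_of_nonneg_right ?_ D0.le
  have c1 := mul_le_mul_of_nonneg_left b1 hA.le
  have c2 := mul_le_mul_of_nonneg_left (add_le_add b2 b3) hB
  have p1 : 0 ≤ A * (M * h ^ (-aR)) := by positivity
  have p2 : 0 ≤ B * (M * h ^ (-(ar - 2))) := by positivity
  linarith
end

section
/- Let α_r > 1, β_r > 0, α_R > 0, β_R > 0 and h ≥ 0. Then ∫₀^∞∫₀^∞∫₀^∞ (RP/r) · e^{-Ph} · (∫_{s=0}^∞ ∫_{u=-h}^∞ e^{-Rs - Pu - r|s-u|} du ds) γ_{α_r,β_r}(r) γ_{α_R,β_R}(R) γ_{α_R,β_R}(P) dr dR dP = I₂(h) + I₃(h). -/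
open MeasureTheory Set Real Filter

lemma aux_inner (R P r h s : ℝ) (hR : 0 < R) (hP : 0 < P) (hr : 0 < r) (hh : 0 ≤ h)
    (hne : r ≠ P) (hs : 0 < s) :
    (∫ u in Ioi (-h), Real.exp (-R * s - P * u - r * |s - u|)) =
      (1 / (r - P) + 1 / (P + r)) * Real.exp (-(P + R) * s)
        - Real.exp ((P - r) * h) / (r - P) * Real.exp (-(R + r) * s) := by
  have hlt : -h ≤ s := by linarith
  have hrp : r - P ≠ 0 := sub_ne_zero.mpr hne
  have hPr : P + r ≠ 0 := by positivity
  have e1 : EqOn (fun u => Real.exp (-R * s - P * u - r * |s - u|))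
      (fun u => Real.exp (-(R + r) * s) * Real.exp ((r - P) * u)) (Ioc (-h) s) := by
    intro u hu
    simp only
    rw [abs_of_nonneg (by linarith [hu.2]), ← Real.exp_add]
    congr 1; ring
  have e2 : EqOn (fun u => Real.exp (-R * s - P * u - r * |s - u|))
      (fun u => Real.exp ((r - R) * s) * Real.exp (-(P + r) * u)) (Ioi s) := by
    intro u hu
    simp only
    rw [abs_of_nonpos (by linarith [mem_Ioi.mp hu]), ← Real.exp_add]
    congr 1; ring
  have i1 : IntegrableOn (fun u => Real.exp (-R * s - P * u - r * |s - u|)) (Ioc (-h) s) := by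
    apply Continuous.integrableOn_Ioc
    fun_prop
  have i2 : IntegrableOn (fun u => Real.exp (-R * s - P * u - r * |s - u|)) (Ioi s) := by
    rw [integrableOn_congr_fun e2 measurableSet_Ioi]
    exact (integrableOn_exp_mul_Ioi (by linarith) s).const_mul _
  rw [← Ioc_union_Ioi_eq_Ioi hlt, setIntegral_union (Ioc_disjoint_Ioi le_rfl) measurableSet_Ioi i1 i2,
    setIntegral_congr_fun measurableSet_Ioc e1, setIntegral_congr_fun measurableSet_Ioi e2,
    integral_const_mul, integral_const_mul, integral_exp_mul_Ioi (by linarith),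
    ← intervalIntegral.integral_of_le hlt,
    intervalIntegral.integral_comp_mul_left (fun x => Real.exp x) hrp, integral_exp]
  have a1 : Real.exp (-(P + R) * s) = Real.exp (-(R + r) * s) * Real.exp ((r - P) * s) := by
    rw [← Real.exp_add]; congr 1; ring
  have a2 : Real.exp ((r - R) * s) * Real.exp (-(P + r) * s) = Real.exp (-(P + R) * s) := by
    rw [← Real.exp_add]; congr 1; ring
  have a3 : (r - P) * -h = (P - r) * h := by ring
  rw [a3, neg_div_neg_eq, ← mul_div_assoc, a2, a1, smul_eq_mul]
  field_simp
  ring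

lemma aux_double (R P r h : ℝ) (hR : 0 < R) (hP : 0 < P) (hr : 0 < r) (hh : 0 ≤ h)
    (hne : r ≠ P) :
    Real.exp (-P * h) * (∫ s in Ioi (0:ℝ), ∫ u in Ioi (-h), Real.exp (-R * s - P * u - r * |s - u|)) =
      1 / (P + R) * (1 / (P + r) + 1 / (R + r)) * Real.exp (-P * h)
       + 1 / ((R + r) * (P - r)) * (Real.exp (-r * h) - Real.exp (-P * h)) := by
  rw [setIntegral_congr_fun measurableSet_Ioi
    (fun s hs => aux_inner R P r h s hR hP hr hh hne hs)]
  rw [integral_sub ((integrableOn_exp_mul_Ioi (by linarith) 0).const_mul _)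
    ((integrableOn_exp_mul_Ioi (by linarith) 0).const_mul _), integral_const_mul,
    integral_const_mul, integral_exp_mul_Ioi (by linarith), integral_exp_mul_Ioi (by linarith)]
  have a1 : Real.exp (-r * h) = Real.exp (-P * h) * Real.exp ((P - r) * h) := by
    rw [← Real.exp_add]; congr 1; ring
  have hrp : r - P ≠ 0 := sub_ne_zero.mpr hne
  have hrp' : P - r ≠ 0 := sub_ne_zero.mpr hne.symm
  have h1 : P - r = -(r - P) := by ring
  have h2 : P + r ≠ 0 := by positivity
  have h3 : P + R ≠ 0 := by positivity
  have h4 : R + r ≠ 0 := by positivity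
  rw [a1, mul_zero, mul_zero, Real.exp_zero, neg_div_neg_eq, neg_div_neg_eq]
  generalize Real.exp ((P - r) * h) = E
  rw [h1]
  generalize Real.exp (-P * h) = F
  field_simp
  ring

lemma aux_gd_nonneg (a b x : ℝ) (ha : 0 < a) (hb : 0 < b) (hx : 0 < x) :
    0 ≤ gammaDensity a b x := by
  unfold gammaDensity
  have := Real.Gamma_pos_of_pos ha
  positivity

lemma aux_gd_meas (a b : ℝ) : Measurable (gammaDensity a b) := by
  unfold gammaDensity
  fun_prop

lemma aux_gd_int (a b c : ℝ) (hb : 0 < b) (hac : 0 < a + c) :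
    IntegrableOn (fun x => x ^ c * gammaDensity a b x) (Ioi 0) := by
  have h := (integrableOn_rpow_mul_exp_neg_mul_rpow (s := a + c - 1) (p := 1) (b := 1 / b)
    (by linarith) (by norm_num) (by positivity)).const_mul (1 / (Real.Gamma a * b ^ a))
  refine IntegrableOn.congr_fun h ?_ measurableSet_Ioi
  intro x hx
  have hx' : (0:ℝ) < x := hx
  simp only [gammaDensity]
  rw [show a + c - 1 = c + (a - 1) by ring, Real.rpow_add hx', Real.rpow_one,
    show -(1 / b) * x = - x / b by ring]
  ring

lemma aux_exp_s9 (P r h : ℝ) (hP : 0 < P) (hr : 0 < r) (hh : 0 ≤ h) :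
    |(Real.exp (-r * h) - Real.exp (-P * h)) / (P - r)| ≤ h := by
  have key : ∀ p q : ℝ, 0 < q → q < p →
      |(Real.exp (-q * h) - Real.exp (-p * h)) / (p - q)| ≤ h := by
    intro p q hq hqp
    have hpq : 0 < p - q := by linarith
    have e : Real.exp (-p * h) = Real.exp (-q * h) * Real.exp (-((p - q) * h)) := by
      rw [← Real.exp_add]; congr 1; ring
    have h1 : Real.exp (-q * h) ≤ 1 := Real.exp_le_one_iff.mpr (by nlinarith)
    have h2 : 1 - (p - q) * h ≤ Real.exp (-((p - q) * h)) := Real.one_sub_le_exp_neg _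
    have h3 : Real.exp (-((p - q) * h)) ≤ 1 := Real.exp_le_one_iff.mpr (by
      have := mul_nonneg hpq.le hh; linarith)
    have h4 := Real.exp_pos (-q * h)
    have h5 := mul_nonneg hpq.le hh
    rw [e, abs_of_nonneg (div_nonneg (by nlinarith) hpq.le), div_le_iff₀ hpq]
    nlinarith
  rcases lt_trichotomy r P with hlt | heq | hlt
  · exact key P r hr hlt
  · subst heq; simpa using hh
  · have := key r P hP hlt
    rwa [← neg_sub (Real.exp (-r * h)), ← neg_sub P r, neg_div_neg_eq] at this

noncomputable def auxF (ar br aR bR h : ℝ) (z : ℝ × ℝ × ℝ) : ℝ :=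
  (z.2.1 * z.1 / (z.2.2 * (z.1 + z.2.1))) * (1 / (z.1 + z.2.2) + 1 / (z.2.1 + z.2.2))
    * Real.exp (-z.1 * h) *
      gammaDensity ar br z.2.2 * gammaDensity aR bR z.2.1 * gammaDensity aR bR z.1

noncomputable def auxG (ar br aR bR h : ℝ) (z : ℝ × ℝ × ℝ) : ℝ :=
  (z.2.1 * z.1 / (z.2.2 * (z.2.1 + z.2.2) * (z.1 - z.2.2))) *
        (Real.exp (-z.2.2 * h) - Real.exp (-z.1 * h)) *
      gammaDensity ar br z.2.2 * gammaDensity aR bR z.2.1 * gammaDensity aR bR z.1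

lemma aux_ae_pos : ∀ᵐ z : ℝ × ℝ × ℝ ∂((volume.restrict (Ioi (0:ℝ))).prod
    ((volume.restrict (Ioi (0:ℝ))).prod (volume.restrict (Ioi (0:ℝ))))),
    0 < z.1 ∧ 0 < z.2.1 ∧ 0 < z.2.2 := by
  rw [Measure.prod_restrict, Measure.prod_restrict]
  filter_upwards [ae_restrict_mem (measurableSet_Ioi.prod (measurableSet_Ioi.prod measurableSet_Ioi))]
    with z hz
  exact ⟨hz.1, hz.2.1, hz.2.2⟩

lemma aux_prod_int (ar br aR bR c : ℝ) (har : 1 < ar) (hbr : 0 < br)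
    (haR : 0 < aR) (hbR : 0 < bR) (hc : 0 ≤ c) :
    Integrable (fun z : ℝ × ℝ × ℝ => (z.1 ^ c * gammaDensity aR bR z.1) *
      ((z.2.1 ^ (0:ℝ) * gammaDensity aR bR z.2.1) * (z.2.2 ^ (-1:ℝ) * gammaDensity ar br z.2.2)))
      ((volume.restrict (Ioi (0:ℝ))).prod
        ((volume.restrict (Ioi (0:ℝ))).prod (volume.restrict (Ioi (0:ℝ))))) :=
  Integrable.mul_prod (aux_gd_int aR bR c hbR (by linarith))
    (Integrable.mul_prod (aux_gd_int aR bR 0 hbR (by linarith))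
      (aux_gd_int ar br (-1) hbr (by linarith)))

lemma auxF_int (ar br aR bR h : ℝ) (har : 1 < ar) (hbr : 0 < br)
    (haR : 0 < aR) (hbR : 0 < bR) (hh : 0 ≤ h) :
    Integrable (auxF ar br aR bR h) ((volume.restrict (Ioi (0:ℝ))).prod
        ((volume.restrict (Ioi (0:ℝ))).prod (volume.restrict (Ioi (0:ℝ))))) := by
  have m1 := aux_gd_meas ar br
  have m2 := aux_gd_meas aR bR
  refine Integrable.mono' ((aux_prod_int ar br aR bR 0 har hbr haR hbR le_rfl).const_mul 2) ?_ ?_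
  · apply Measurable.aestronglyMeasurable
    unfold auxF
    fun_prop
  · filter_upwards [aux_ae_pos] with z hz
    obtain ⟨P, R, r⟩ := z
    obtain ⟨hP, hR, hr⟩ := hz
    simp only [auxF] at *
    have g1 := aux_gd_nonneg ar br r (by linarith) hbr hr
    have g2 := aux_gd_nonneg aR bR R haR hbR hR
    have g3 := aux_gd_nonneg aR bR P haR hbR hP
    rw [Real.norm_of_nonneg (by positivity), Real.rpow_zero, Real.rpow_zero, Real.rpow_neg_one]
    have e1 : Real.exp (-P * h) ≤ 1 := Real.exp_le_one_iff.mpr (by nlinarith)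
    have b : (R * P / (r * (P + R))) * (1 / (P + r) + 1 / (R + r)) ≤ 2 * r⁻¹ := by
      have b1 : R / (P + R) * (P / (P + r)) ≤ 1 :=
        mul_le_one₀ ((div_le_one (by positivity)).2 (by linarith)) (by positivity)
          ((div_le_one (by positivity)).2 (by linarith))
      have b2 : P / (P + R) * (R / (R + r)) ≤ 1 :=
        mul_le_one₀ ((div_le_one (by positivity)).2 (by linarith)) (by positivity)
          ((div_le_one (by positivity)).2 (by linarith))
      have : (R * P / (r * (P + R))) * (1 / (P + r) + 1 / (R + r))
        = (R / (P + R) * (P / (P + r)) + P / (P + R) * (R / (R + r))) * r⁻¹ := by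
        field_simp
      rw [this]
      gcongr
      linarith
    calc _ ≤ (2 * r⁻¹) * 1 * gammaDensity ar br r * gammaDensity aR bR R * gammaDensity aR bR P := by
          gcongr
      _ = _ := by ring

lemma auxG_int (ar br aR bR h : ℝ) (har : 1 < ar) (hbr : 0 < br)
    (haR : 0 < aR) (hbR : 0 < bR) (hh : 0 ≤ h) :
    Integrable (auxG ar br aR bR h) ((volume.restrict (Ioi (0:ℝ))).prod
        ((volume.restrict (Ioi (0:ℝ))).prod (volume.restrict (Ioi (0:ℝ))))) := by
  have m1 := aux_gd_meas ar br
  have m2 := aux_gd_meas aR bR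
  refine Integrable.mono' ((aux_prod_int ar br aR bR 1 har hbr haR hbR zero_le_one).const_mul h) ?_ ?_
  · apply Measurable.aestronglyMeasurable
    unfold auxG
    fun_prop
  · filter_upwards [aux_ae_pos] with z hz
    obtain ⟨P, R, r⟩ := z
    obtain ⟨hP, hR, hr⟩ := hz
    simp only [auxG] at *
    have g1 := aux_gd_nonneg ar br r (by linarith) hbr hr
    have g2 := aux_gd_nonneg aR bR R haR hbR hR
    have g3 := aux_gd_nonneg aR bR P haR hbR hP
    have b := aux_exp_s9 P r h hP hr hh
    have b1 : R / (R + r) ≤ 1 := (div_le_one (by positivity)).2 (by linarith)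
    rw [Real.rpow_zero, Real.rpow_one, Real.rpow_neg_one]
    have e : (R * P / (r * (R + r) * (P - r))) * (Real.exp (-r * h) - Real.exp (-P * h)) *
      gammaDensity ar br r * gammaDensity aR bR R * gammaDensity aR bR P
      = ((Real.exp (-r * h) - Real.exp (-P * h)) / (P - r)) * (R / (R + r) * (P * r⁻¹ *
      gammaDensity ar br r * gammaDensity aR bR R * gammaDensity aR bR P)) := by
      simp only [div_eq_mul_inv, mul_inv]; ring
    rw [e, Real.norm_eq_abs, abs_mul]
    rw [abs_of_nonneg (a := R / (R + r) * _) (by positivity)]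
    calc _ ≤ h * (1 * (P * r⁻¹ *
          gammaDensity ar br r * gammaDensity aR bR R * gammaDensity aR bR P)) := by
          gcongr
      _ = _ := by ring

lemma aux_iter (μ : Measure ℝ) [SFinite μ] (F : ℝ × ℝ × ℝ → ℝ)
    (hF : Integrable F (μ.prod (μ.prod μ))) :
    (∫ P, ∫ R, ∫ r, F (P, R, r) ∂μ ∂μ ∂μ) = ∫ z, F z ∂(μ.prod (μ.prod μ)) := by
  rw [integral_prod _ hF]
  refine integral_congr_ae ?_
  filter_upwards [hF.prod_right_ae] with P hP
  rw [integral_prod _ hP]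

theorem stmt9 (ar br aR bR h : ℝ) (har : 1 < ar) (hbr : 0 < br)
    (haR : 0 < aR) (hbR : 0 < bR) (hh : 0 ≤ h) :
    (∫ P in Ioi (0:ℝ), ∫ R in Ioi (0:ℝ), ∫ r in Ioi (0:ℝ),
        (R * P / r) * Real.exp (-P * h) *
          (∫ s in Ioi (0:ℝ), ∫ u in Ioi (-h),
            Real.exp (-R * s - P * u - r * |s - u|)) *
          gammaDensity ar br r * gammaDensity aR bR R * gammaDensity aR bR P) =
      I2 ar br aR bR h + I3 ar br aR bR h := by
  have hF := auxF_int ar br aR bR h har hbr haR hbR hh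
  have hG := auxG_int ar br aR bR h har hbr haR hbR hh
  have hne : ∀ P : ℝ, ∀ᵐ r ∂(volume.restrict (Ioi (0:ℝ))), r ≠ P := fun P =>
    ae_restrict_of_ae (Measure.ae_ne volume P)
  have e2 : I2 ar br aR bR h = ∫ P in Ioi (0:ℝ), ∫ R in Ioi (0:ℝ), ∫ r in Ioi (0:ℝ),
      auxF ar br aR bR h (P, R, r) := rfl
  have e3 : I3 ar br aR bR h = ∫ P in Ioi (0:ℝ), ∫ R in Ioi (0:ℝ), ∫ r in Ioi (0:ℝ),
      auxG ar br aR bR h (P, R, r) := by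
    unfold I3
    congr 1; ext P; congr 1; ext R
    refine integral_congr_ae ?_
    filter_upwards [hne P] with r hr
    simp only [auxG]
    rw [if_neg (Ne.symm hr)]
  rw [e2, e3, aux_iter _ _ hF, aux_iter _ _ hG, ← integral_add hF hG]
  have := aux_iter _ _ (hF.add hG)
  simp only [Pi.add_apply] at this
  rw [← this]
  refine setIntegral_congr_fun measurableSet_Ioi (fun P hP => ?_)
  refine setIntegral_congr_fun measurableSet_Ioi (fun R hR => ?_)
  refine integral_congr_ae ?_
  filter_upwards [hne P, ae_restrict_mem measurableSet_Ioi] with r hr hr0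
  simp only [auxF, auxG]
  have k := aux_double R P r h hR hP hr0 hh hr
  rw [mul_assoc (R * P / r), k]
  simp only [div_eq_mul_inv, mul_inv]
  ring
end
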